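/- arXiv:2303.01512 — 4 statements merged into one kernel-verified Lean document; each statement's English description precedes it below -/
import Mathlib

section
/- Suppose the likelihood potential Φ satisfies Assumption A with functions (f,g,h) and that f ∈ L¹(X,μ). Then for every fixed y ∈ Y the normalizing constant satisfies 0 < Z(y) < ∞, so that the posterior ν defined by dν/dμ(u) = exp(−Φ(u;y))/Z(y) is a well-defined Borel probability measure on X. -/
open MeasureTheory Real ENNReal

/-- The integral probability metric `D(η₁, η₂; c)`: supremum of `∫ψ dη₁ − ∫ψ dη₂` over
functions `ψ` vanishing at the origin that are Lipschitz-1 with respect to the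
distance-like function `c`. -/
noncomputable def ipm {X : Type*} [MeasurableSpace X] [Zero X]
    (c : X → X → ℝ) (η₁ η₂ : Measure X) : ℝ :=
  sSup {r : ℝ | ∃ ψ : X → ℝ, ψ 0 = 0 ∧ (∀ u v, |ψ u - ψ v| ≤ c u v) ∧
    r = (∫ u, ψ u ∂η₁) - ∫ u, ψ u ∂η₂}

/-- The optimal transport cost `W(η₁, η₂; c)`: infimum of `∫ c dπ` over couplings `π`
of `(η₁, η₂)`. -/
noncomputable def otCost {X : Type*} [MeasurableSpace X]
    (c : X → X → ℝ) (η₁ η₂ : Measure X) : ℝ≥0∞ :=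
  ⨅ pl ∈ {pl : Measure (X × X) |
      pl.map Prod.fst = η₁ ∧ pl.map Prod.snd = η₂ ∧ IsProbabilityMeasure pl},
    ∫⁻ p, ENNReal.ofReal (c p.1 p.2) ∂pl

/-- `c : X × X → ℝ` is distance-like: nonnegative, symmetric, lower semicontinuous and
vanishing exactly on the diagonal. -/
def DistanceLike {X : Type*} [TopologicalSpace X] (c : X → X → ℝ) : Prop :=
  (∀ u v, 0 ≤ c u v) ∧ (∀ u v, c u v = c v u) ∧
    LowerSemicontinuous (fun p : X × X => c p.1 p.2) ∧
    ∀ u v, c u v = 0 ↔ u = v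

/-- The posterior measure with prior `μ` and likelihood potential `Φ`:
`dν/dμ (u) = exp (−Φ u) / Z` with `Z = ∫ exp (−Φ u) dμ(u)`. -/
noncomputable def post {X : Type*} [MeasurableSpace X]
    (μ : Measure X) (Φ : X → ℝ) : Measure X :=
  μ.withDensity fun u => ENNReal.ofReal (Real.exp (-Φ u) / ∫ v, Real.exp (-Φ v) ∂μ)

/-- Assumption A on a likelihood potential `Φ : X × Y → ℝ` with functions `(f, g, h)`:
(i) `Φ(·; y)` is `μ`-measurable for every `y`; (ii) `f : X → (0,∞)` is lower
semicontinuous, `g : Y → (0,∞)` and `h : X × Y → (0,∞)` are locally bounded, and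
`−log f(u) − log g(y) ≤ Φ(u; y) ≤ −log h(u, y)` for all `(u, y)`. -/
structure AssumptionA {X Y : Type*} [MeasurableSpace X] [TopologicalSpace X]
    [TopologicalSpace Y] (μ : Measure X) (Φ : X → Y → ℝ)
    (f : X → ℝ) (g : Y → ℝ) (h : X → Y → ℝ) : Prop where
  measurable : ∀ y, AEMeasurable (fun u => Φ u y) μ
  f_pos : ∀ u, 0 < f u
  f_lsc : LowerSemicontinuous f
  g_pos : ∀ y, 0 < g y
  g_locBdd : ∀ y : Y, ∃ s ∈ nhds y, BddAbove (g '' s)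
  h_pos : ∀ u y, 0 < h u y
  h_locBdd : ∀ p : X × Y, ∃ s ∈ nhds p, BddAbove ((fun q : X × Y => h q.1 q.2) '' s)
  lower_bound : ∀ u y, -Real.log (f u) - Real.log (g y) ≤ Φ u y
  upper_bound : ∀ u y, Φ u y ≤ -Real.log (h u y)

/-- Under Assumption A with `f ∈ L¹(X, μ)`, for every fixed `y ∈ Y` the
normalizing constant satisfies `0 < Z(y) < ∞`, so the posterior
`dν/dμ (u) = exp(−Φ(u;y))/Z(y)` is a well-defined Borel probability measure on `X`. -/
theorem posterior_well_defined
    {X Y : Type*} [NormedAddCommGroup X] [NormedSpace ℝ X] [CompleteSpace X]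
    [SecondCountableTopology X] [MeasurableSpace X] [BorelSpace X]
    [NormedAddCommGroup Y] [NormedSpace ℝ Y] [CompleteSpace Y] [SecondCountableTopology Y]
    (μ : Measure X) [IsProbabilityMeasure μ]
    (Φ : X → Y → ℝ) (f : X → ℝ) (g : Y → ℝ) (h : X → Y → ℝ)
    (hA : AssumptionA μ Φ f g h) (hf : Integrable f μ) (y : Y) :
    0 < ∫⁻ u, ENNReal.ofReal (Real.exp (-Φ u y)) ∂μ ∧
      (∫⁻ u, ENNReal.ofReal (Real.exp (-Φ u y)) ∂μ) < ⊤ ∧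
      IsProbabilityMeasure (μ.withDensity fun u =>
        ENNReal.ofReal (Real.exp (-Φ u y)) / ∫⁻ v, ENNReal.ofReal (Real.exp (-Φ v y)) ∂μ) := by
  have hpos : 0 < ∫⁻ u, ENNReal.ofReal (Real.exp (-Φ u y)) ∂μ := by
    have hm : AEMeasurable (fun u => ENNReal.ofReal (Real.exp (-Φ u y))) μ :=
      (Real.measurable_exp.comp_aemeasurable (hA.measurable y).neg).ennreal_ofReal
    rw [pos_iff_ne_zero, Ne, lintegral_eq_zero_iff' hm]
    intro h0
    obtain ⟨u, hu⟩ := h0.exists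
    exact (ENNReal.ofReal_pos.2 (Real.exp_pos (-Φ u y))).ne' hu
  have hfin : (∫⁻ u, ENNReal.ofReal (Real.exp (-Φ u y)) ∂μ) < ⊤ := by
    refine lt_of_le_of_lt (lintegral_mono fun u => ENNReal.ofReal_le_ofReal ?_)
      (hf.mul_const (g y)).lintegral_lt_top
    calc Real.exp (-Φ u y) ≤ Real.exp (Real.log (f u) + Real.log (g y)) :=
          Real.exp_le_exp.2 (by linarith [hA.lower_bound u y])
      _ = f u * g y := by
          rw [Real.exp_add, Real.exp_log (hA.f_pos u), Real.exp_log (hA.g_pos y)]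
  refine ⟨hpos, hfin, ⟨?_⟩⟩
  rw [withDensity_apply _ MeasurableSet.univ, Measure.restrict_univ]
  simp_rw [div_eq_mul_inv]
  rw [lintegral_mul_const' _ _ (ENNReal.inv_ne_top.2 hpos.ne')]
  exact ENNReal.mul_inv_cancel hpos.ne' hfin.ne
end

section
/- Suppose the likelihood potentials Φ and Φ' both satisfy Assumption A with the same functions (f,g,h), and let p,q ∈ [1,∞] satisfy 1/p + 1/q = 1. Let ν and ν' be the posteriors obtained from the prior μ with potentials Φ and Φ' respectively, at data y ∈ Y. Then for every y ∈ Y, D(ν,ν';c) ≤ (2 g(y)² ‖f·c(·,0)‖_{L^p(μ)} ‖f‖_{L^p(μ)} / ‖h(·,y)‖_{L¹(μ)}²) · ‖Φ(·;y) − Φ'(·;y)‖_{L^q(μ)}. -/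
open MeasureTheory Real ENNReal

/-- Hölder's inequality for conjugate exponents, as a bound on a Bochner integral. -/
lemma MeasureTheory.MemLp.integrable_mul_and_integral_abs_mul_le {X : Type*}
    [MeasurableSpace X] {μ : Measure X} {p q : ℝ≥0∞} (hpq : 1 / p + 1 / q = 1)
    {F G : X → ℝ} (hF : MemLp F p μ) (hG : MemLp G q μ) :
    Integrable (fun u => F u * G u) μ ∧
      ∫ u, |F u * G u| ∂μ ≤ (eLpNorm F p μ).toReal * (eLpNorm G q μ).toReal := by
  have : ENNReal.HolderTriple p q 1 := ⟨by simpa using hpq⟩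
  have hint : Integrable (fun u => F u * G u) μ := hF.integrable_mul hG
  refine ⟨hint, ?_⟩
  have hle : eLpNorm (F • G) 1 μ ≤ eLpNorm F p μ * eLpNorm G q μ :=
    eLpNorm_smul_le_mul_eLpNorm hG.1 hF.1
  have heq : ∫ u, |F u * G u| ∂μ = (eLpNorm (F • G) 1 μ).toReal := by
    rw [eLpNorm_one_eq_lintegral_enorm]
    exact integral_norm_eq_lintegral_enorm hint.1
  rw [heq, ← ENNReal.toReal_mul]
  exact ENNReal.toReal_mono (ENNReal.mul_ne_top hF.2.ne hG.2.ne) hle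

lemma MeasureTheory.MemLp.integral_abs_le_toReal_eLpNorm {X : Type*}
    [MeasurableSpace X] {μ : Measure X} [IsProbabilityMeasure μ] {p : ℝ≥0∞} (hp : 1 ≤ p)
    {F : X → ℝ} (hF : MemLp F p μ) : ∫ u, |F u| ∂μ ≤ (eLpNorm F p μ).toReal := by
  have heq : ∫ u, |F u| ∂μ = (eLpNorm F 1 μ).toReal := by
    rw [eLpNorm_one_eq_lintegral_enorm]
    exact integral_norm_eq_lintegral_enorm hF.1
  rw [heq]
  exact ENNReal.toReal_mono hF.2.ne (eLpNorm_le_eLpNorm_of_exponent_le hp hF.1)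

lemma abs_exp_neg_sub_exp_neg_le {a b K : ℝ} (ha : Real.exp (-a) ≤ K)
    (hb : Real.exp (-b) ≤ K) : |Real.exp (-a) - Real.exp (-b)| ≤ K * |a - b| := by
  wlog hab : a ≤ b generalizing a b
  · rw [abs_sub_comm, abs_sub_comm a]
    exact this hb ha (le_of_not_ge hab)
  have hexp : Real.exp (-b) = Real.exp (-a) * Real.exp (a - b) := by
    rw [← Real.exp_add]; ring_nf
  have hlin := Real.add_one_le_exp (a - b)
  rw [abs_of_nonneg (sub_nonneg.2 (Real.exp_le_exp.2 (neg_le_neg hab))),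
    abs_of_nonpos (sub_nonpos.2 hab)]
  calc Real.exp (-a) - Real.exp (-b) = Real.exp (-a) * (1 - Real.exp (a - b)) := by
        rw [hexp]; ring
    _ ≤ Real.exp (-a) * (-(a - b)) :=
        mul_le_mul_of_nonneg_left (by linarith) (Real.exp_pos _).le
    _ ≤ K * (-(a - b)) := mul_le_mul_of_nonneg_right ha (by linarith)

lemma integral_post {X : Type*} [MeasurableSpace X] {μ : Measure X} {Φ : X → ℝ}
    (hΦ : AEMeasurable Φ μ) (ψ : X → ℝ) :
    ∫ u, ψ u ∂(post μ Φ) =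
      (∫ u, Real.exp (-Φ u) * ψ u ∂μ) / ∫ v, Real.exp (-Φ v) ∂μ := by
  have hZ : 0 ≤ ∫ v, Real.exp (-Φ v) ∂μ := integral_nonneg fun v => (Real.exp_pos _).le
  have hm : AEMeasurable
      (fun u => ENNReal.ofReal (Real.exp (-Φ u) / ∫ v, Real.exp (-Φ v) ∂μ)) μ :=
    ((Real.measurable_exp.comp_aemeasurable hΦ.neg).div_const _).ennreal_ofReal
  rw [post, integral_withDensity_eq_integral_toReal_smul₀ hm (by simp), ← integral_div]
  refine integral_congr_ae (Filter.Eventually.of_forall fun u => ?_)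
  simp only [smul_eq_mul]
  rw [ENNReal.toReal_ofReal (div_nonneg (Real.exp_pos _).le hZ)]
  ring

lemma post_congr_ae {X : Type*} [MeasurableSpace X] {μ : Measure X} {Φ Φ' : X → ℝ}
    (hΦ : Φ =ᵐ[μ] Φ') : post μ Φ = post μ Φ' := by
  have hZ : ∫ v, Real.exp (-Φ v) ∂μ = ∫ v, Real.exp (-Φ' v) ∂μ :=
    integral_congr_ae (hΦ.mono fun u hu => by simp only [hu])
  unfold post
  rw [hZ]
  exact withDensity_congr_ae (hΦ.mono fun u hu => by simp only [hu])

/-- A posterior expectation vanishes when the unnormalized likelihood dominates a function of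
infinite lower integral. -/
lemma integral_post_eq_zero_of_eLpNorm_eq_top {X : Type*} [MeasurableSpace X] {μ : Measure X}
    {Φ h : X → ℝ} (hΦ : AEMeasurable Φ μ) (hpos : ∀ u, 0 < h u)
    (hle : ∀ u, h u ≤ Real.exp (-Φ u)) (htop : eLpNorm h 1 μ = ⊤) (ψ : X → ℝ) :
    ∫ u, ψ u ∂(post μ Φ) = 0 := by
  have hni : ¬ Integrable (fun u => Real.exp (-Φ u)) μ := fun hi => by
    refine (memLp_one_iff_integrable.2 hi).2.ne (top_le_iff.1 ?_)
    rw [← htop]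
    refine eLpNorm_mono fun u => ?_
    rw [Real.norm_of_nonneg (hpos u).le, Real.norm_of_nonneg (Real.exp_pos _).le]
    exact hle u
  rw [integral_post hΦ, integral_undef hni, _root_.div_zero]

lemma toReal_eLpNorm_le_integral_exp {X : Type*} [MeasurableSpace X] {μ : Measure X}
    {Φ h : X → ℝ} (hi : Integrable (fun u => Real.exp (-Φ u)) μ) (hpos : ∀ u, 0 < h u)
    (hle : ∀ u, h u ≤ Real.exp (-Φ u)) :
    (eLpNorm h 1 μ).toReal ≤ ∫ u, Real.exp (-Φ u) ∂μ := by
  have hmono : eLpNorm h 1 μ ≤ eLpNorm (fun u => Real.exp (-Φ u)) 1 μ :=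
    eLpNorm_mono fun u => by
      rw [Real.norm_of_nonneg (hpos u).le, Real.norm_of_nonneg (Real.exp_pos _).le]
      exact hle u
  have heq : ∫ u, Real.exp (-Φ u) ∂μ
      = (eLpNorm (fun u => Real.exp (-Φ u)) 1 μ).toReal := by
    rw [eLpNorm_one_eq_lintegral_enorm, ← integral_norm_eq_lintegral_enorm hi.1]
    simp only [Real.norm_of_nonneg (Real.exp_pos _).le]
  rw [heq]
  exact ENNReal.toReal_mono (memLp_one_iff_integrable.2 hi).2.ne hmono

/-- The difference of two ratios `I / Z - I' / Z'`, bounded by the perturbations of the numerators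
and of the denominators. -/
lemma div_sub_div_le_of_abs_sub_le {I I' Z Z' H G M N E : ℝ} (hH : 0 < H) (hZ : H ≤ Z)
    (hZ' : H ≤ Z') (hM : 0 ≤ M) (hE : 0 ≤ E) (hG : 0 ≤ G) (hN : 0 ≤ N)
    (hI : |I - I'| ≤ G * (M * E)) (hI' : |I'| ≤ G * M) (hZN : Z' ≤ G * N)
    (hZZ' : |Z - Z'| ≤ G * (N * E)) :
    I / Z - I' / Z' ≤ 2 * G ^ 2 * M * N / H ^ 2 * E := by
  have hZpos : 0 < Z := hH.trans_le hZ
  have hZpos' : 0 < Z' := hH.trans_le hZ'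
  have hsplit : I / Z - I' / Z' = ((I - I') * Z' + I' * (Z' - Z)) / (Z * Z') := by
    field_simp; ring
  have hnum : (I - I') * Z' + I' * (Z' - Z) ≤ 2 * G ^ 2 * M * N * E := by
    have h1 : (I - I') * Z' ≤ (G * (M * E)) * (G * N) :=
      mul_le_mul ((le_abs_self _).trans hI) hZN hZpos'.le (by positivity)
    have h2 : I' * (Z' - Z) ≤ (G * M) * (G * (N * E)) := by
      refine (le_abs_self _).trans ?_
      rw [abs_mul, abs_sub_comm]
      exact mul_le_mul hI' hZZ' (abs_nonneg _) (by positivity)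
    linarith
  have hden : H ^ 2 ≤ Z * Z' := by
    rw [sq]; exact mul_le_mul hZ hZ' hH.le hZpos.le
  rw [hsplit, div_mul_eq_mul_div]
  exact div_le_div₀ (by positivity) hnum (by positivity) hden

/-- Stability of a single posterior expectation under perturbation of the potential, for an
observable `ψ` dominated by `d`. -/
lemma integral_post_sub_integral_post_le {X : Type*} [MeasurableSpace X] {μ : Measure X}
    [IsProbabilityMeasure μ] {p q : ℝ≥0∞} (hp : 1 ≤ p) (hpq : 1 / p + 1 / q = 1)
    {Φ Φ' f d h ψ : X → ℝ} {G : ℝ} (hG : 0 < G)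
    (hΦ : AEMeasurable Φ μ) (hΦ' : AEMeasurable Φ' μ)
    (hf : ∀ u, 0 < f u) (hh : ∀ u, 0 < h u) (hψ : ∀ u, |ψ u| ≤ d u)
    (hub : ∀ u, Real.exp (-Φ u) ≤ G * f u) (hub' : ∀ u, Real.exp (-Φ' u) ≤ G * f u)
    (hlb : ∀ u, h u ≤ Real.exp (-Φ u)) (hlb' : ∀ u, h u ≤ Real.exp (-Φ' u))
    (hfd : MemLp (fun u => f u * d u) p μ) (hfp : MemLp f p μ)
    (hΔ : MemLp (fun u => Φ u - Φ' u) q μ) (hH : 0 < (eLpNorm h 1 μ).toReal) :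
    ∫ u, ψ u ∂(post μ Φ) - ∫ u, ψ u ∂(post μ Φ') ≤
      2 * G ^ 2 * (eLpNorm (fun u => f u * d u) p μ).toReal * (eLpNorm f p μ).toReal /
        (eLpNorm h 1 μ).toReal ^ 2 * (eLpNorm (fun u => Φ u - Φ' u) q μ).toReal := by
  have hexpm : ∀ {Ψ : X → ℝ}, AEMeasurable Ψ μ →
      AEStronglyMeasurable (fun u => Real.exp (-Ψ u)) μ := fun hΨ =>
    (Real.measurable_exp.comp_aemeasurable hΨ.neg).aestronglyMeasurable
  have hd : ∀ u, 0 ≤ d u := fun u => (abs_nonneg _).trans (hψ u)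
  have hfi : Integrable f μ := hfp.integrable hp
  have hfdi : Integrable (fun u => f u * d u) μ := hfd.integrable hp
  have hei : ∀ {Ψ : X → ℝ}, AEMeasurable Ψ μ → (∀ u, Real.exp (-Ψ u) ≤ G * f u) →
      Integrable (fun u => Real.exp (-Ψ u)) μ := fun hΨ hle =>
    (hfi.const_mul G).mono' (hexpm hΨ) (Filter.Eventually.of_forall fun u => by
      rw [Real.norm_of_nonneg (Real.exp_pos _).le]; exact hle u)
  rw [integral_post hΦ, integral_post hΦ']
  by_cases hψm : AEStronglyMeasurable ψ μ
  swap
  · have hzero : ∀ {Ψ : X → ℝ}, AEMeasurable Ψ μ →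
        ∫ u, Real.exp (-Ψ u) * ψ u ∂μ = 0 := fun {Ψ} hΨ =>
      integral_non_aestronglyMeasurable fun hm => hψm <| by
        have hmul := (hexpm hΨ.neg).mul hm
        refine hmul.congr (Filter.Eventually.of_forall fun u => ?_)
        simp only [Pi.mul_apply, Pi.neg_apply, neg_neg]
        rw [← mul_assoc, ← Real.exp_add, add_neg_cancel, Real.exp_zero, one_mul]
    rw [hzero hΦ, hzero hΦ', zero_div, zero_div, sub_zero]
    positivity
  have hbound : ∀ {Ψ : X → ℝ}, (∀ u, Real.exp (-Ψ u) ≤ G * f u) → ∀ u,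
      |Real.exp (-Ψ u) * ψ u| ≤ G * |f u * d u| := fun {Ψ} hle u => by
    rw [abs_mul, abs_of_pos (Real.exp_pos _), abs_of_nonneg (mul_nonneg (hf u).le (hd u)),
      ← mul_assoc]
    exact mul_le_mul (hle u) (hψ u) (abs_nonneg _) (mul_pos hG (hf u)).le
  have hpi : ∀ {Ψ : X → ℝ}, AEMeasurable Ψ μ → (∀ u, Real.exp (-Ψ u) ≤ G * f u) →
      Integrable (fun u => Real.exp (-Ψ u) * ψ u) μ := fun hΨ hle =>
    (hfdi.abs.const_mul G).mono' ((hexpm hΨ).mul hψm)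
      (Filter.Eventually.of_forall (hbound hle))
  obtain ⟨hfΔi, hfΔ⟩ := hfp.integrable_mul_and_integral_abs_mul_le hpq hΔ
  obtain ⟨hfdΔi, hfdΔ⟩ := hfd.integrable_mul_and_integral_abs_mul_le hpq hΔ
  refine div_sub_div_le_of_abs_sub_le hH
    (toReal_eLpNorm_le_integral_exp (hei hΦ hub) hh hlb)
    (toReal_eLpNorm_le_integral_exp (hei hΦ' hub') hh hlb')
    ENNReal.toReal_nonneg ENNReal.toReal_nonneg hG.le ENNReal.toReal_nonneg ?_ ?_ ?_ ?_
  · rw [← integral_sub (hpi hΦ hub) (hpi hΦ' hub')]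
    refine abs_integral_le_integral_abs.trans (le_trans ?_ (mul_le_mul_of_nonneg_left hfdΔ hG.le))
    rw [← integral_const_mul]
    refine integral_mono ((hpi hΦ hub).sub (hpi hΦ' hub')).abs (hfdΔi.abs.const_mul G)
      fun u => ?_
    change |Real.exp (-Φ u) * ψ u - Real.exp (-Φ' u) * ψ u|
      ≤ G * |f u * d u * (Φ u - Φ' u)|
    rw [← sub_mul, abs_mul, abs_mul, abs_of_nonneg (mul_nonneg (hf u).le (hd u))]
    calc |Real.exp (-Φ u) - Real.exp (-Φ' u)| * |ψ u|
        ≤ (G * f u * |Φ u - Φ' u|) * d u :=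
          mul_le_mul (abs_exp_neg_sub_exp_neg_le (hub u) (hub' u)) (hψ u) (abs_nonneg _)
            (mul_nonneg (mul_pos hG (hf u)).le (abs_nonneg _))
      _ = G * (f u * d u * |Φ u - Φ' u|) := by ring
  · refine abs_integral_le_integral_abs.trans
      (le_trans ?_ (mul_le_mul_of_nonneg_left (hfd.integral_abs_le_toReal_eLpNorm hp) hG.le))
    rw [← integral_const_mul]
    exact integral_mono (hpi hΦ' hub').abs (hfdi.abs.const_mul G) (hbound hub')
  · refine le_trans ?_ (mul_le_mul_of_nonneg_left (hfp.integral_abs_le_toReal_eLpNorm hp) hG.le)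
    rw [← integral_const_mul]
    exact integral_mono (hei hΦ' hub') (hfi.abs.const_mul G) fun u =>
      (hub' u).trans (mul_le_mul_of_nonneg_left (le_abs_self _) hG.le)
  · rw [← integral_sub (hei hΦ hub) (hei hΦ' hub')]
    refine abs_integral_le_integral_abs.trans (le_trans ?_ (mul_le_mul_of_nonneg_left hfΔ hG.le))
    rw [← integral_const_mul]
    refine integral_mono ((hei hΦ hub).sub (hei hΦ' hub')).abs (hfΔi.abs.const_mul G)
      fun u => ?_
    change |Real.exp (-Φ u) - Real.exp (-Φ' u)| ≤ G * |f u * (Φ u - Φ' u)|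
    rw [abs_mul, abs_of_pos (hf u), ← mul_assoc]
    exact abs_exp_neg_sub_exp_neg_le (hub u) (hub' u)

/-- Under Assumption A the unnormalized likelihood lies between `h` and `g · f`. -/
lemma AssumptionA.le_exp_and_exp_le {X Y : Type*} [MeasurableSpace X] [TopologicalSpace X]
    [TopologicalSpace Y] {μ : Measure X} {Φ : X → Y → ℝ} {f : X → ℝ} {g : Y → ℝ}
    {h : X → Y → ℝ} (hA : AssumptionA μ Φ f g h) (u : X) (y : Y) :
    h u y ≤ Real.exp (-Φ u y) ∧ Real.exp (-Φ u y) ≤ g y * f u := by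
  constructor
  · rw [← Real.log_le_iff_le_exp (hA.h_pos u y)]
    linarith [hA.upper_bound u y]
  · rw [← Real.le_log_iff_exp_le (mul_pos (hA.g_pos y) (hA.f_pos u)),
      Real.log_mul (hA.g_pos y).ne' (hA.f_pos u).ne']
    linarith [hA.lower_bound u y]

/-- Likelihood perturbation bound: if `Φ` and `Φ'` both satisfy
Assumption A with the same `(f,g,h)` and `1/p + 1/q = 1`, then for every `y`,
`D(ν,ν';c) ≤ 2 g(y)² ‖f·c(·,0)‖_{Lᵖ(μ)} ‖f‖_{Lᵖ(μ)} / ‖h(·,y)‖_{L¹(μ)}² ·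
‖Φ(·;y) − Φ'(·;y)‖_{L^q(μ)}`. -/
theorem posterior_likelihood_perturbation
    {X Y : Type*} [NormedAddCommGroup X] [NormedSpace ℝ X] [CompleteSpace X]
    [SecondCountableTopology X] [MeasurableSpace X] [BorelSpace X]
    [NormedAddCommGroup Y] [NormedSpace ℝ Y] [CompleteSpace Y] [SecondCountableTopology Y]
    (μ : Measure X) [IsProbabilityMeasure μ]
    (c : X → X → ℝ) (hc : DistanceLike c)
    (Φ Φ' : X → Y → ℝ) (f : X → ℝ) (g : Y → ℝ) (h : X → Y → ℝ)
    (hA : AssumptionA μ Φ f g h) (hA' : AssumptionA μ Φ' f g h)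
    (p q : ℝ≥0∞) (hp : 1 ≤ p) (hq : 1 ≤ q) (hpq : 1 / p + 1 / q = 1)
    (y : Y) :
    ENNReal.ofReal (ipm c (post μ fun u => Φ u y) (post μ fun u => Φ' u y)) ≤
      2 * ENNReal.ofReal (g y) ^ 2 *
        eLpNorm (fun u => f u * c u 0) p μ * eLpNorm f p μ /
        eLpNorm (fun u => h u y) 1 μ ^ 2 *
        eLpNorm (fun u => Φ u y - Φ' u y) q μ := by
  have hfm : AEStronglyMeasurable f μ := hA.f_lsc.measurable.aestronglyMeasurable
  have hcm : Measurable (fun u => c u 0) :=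
    (hc.2.2.1.comp (by fun_prop : Continuous fun u : X => (u, (0 : X)))).measurable
  have hfcm : AEStronglyMeasurable (fun u => f u * c u 0) μ :=
    hfm.mul hcm.aestronglyMeasurable
  have hΔm : AEStronglyMeasurable (fun u => Φ u y - Φ' u y) μ :=
    ((hA.measurable y).sub (hA'.measurable y)).aestronglyMeasurable
  have hp0 : p ≠ 0 := (zero_lt_one.trans_le hp).ne'
  have hq0 : q ≠ 0 := (zero_lt_one.trans_le hq).ne'
  set M := eLpNorm (fun u => f u * c u 0) p μ with hM
  set N := eLpNorm f p μ with hN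
  set H := eLpNorm (fun u => h u y) 1 μ with hH
  set E := eLpNorm (fun u => Φ u y - Φ' u y) q μ with hE
  by_cases hR : 2 * ENNReal.ofReal (g y) ^ 2 * M * N / H ^ 2 * E = ⊤
  · rw [hR]; exact le_top
  refine ENNReal.ofReal_le_of_le_toReal (Real.sSup_le ?_ ENNReal.toReal_nonneg)
  rintro r ⟨ψ, hψ0, hψ, rfl⟩
  have hψc : ∀ u, |ψ u| ≤ c u 0 := fun u => by simpa [hψ0] using hψ u 0
  by_cases hHtop : H = ⊤
  · rw [integral_post_eq_zero_of_eLpNorm_eq_top (hA.measurable y) (fun u => hA.h_pos u y)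
        (fun u => (hA.le_exp_and_exp_le u y).1) hHtop,
      integral_post_eq_zero_of_eLpNorm_eq_top (hA'.measurable y) (fun u => hA.h_pos u y)
        (fun u => (hA'.le_exp_and_exp_le u y).1) hHtop, sub_zero]
    exact ENNReal.toReal_nonneg
  by_cases hE0 : E = 0
  · have hae : (fun u => Φ u y) =ᵐ[μ] fun u => Φ' u y :=
      ((eLpNorm_eq_zero_iff hΔm hq0).1 hE0).mono fun u hu => sub_eq_zero.1 hu
    rw [post_congr_ae hae, sub_self]
    exact ENNReal.toReal_nonneg
  by_cases hM0 : M = 0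
  · have hψae : ∀ᵐ u ∂μ, ψ u = 0 :=
      ((eLpNorm_eq_zero_iff hfcm hp0).1 hM0).mono fun u hu => by
        have hcu : c u 0 = 0 := (mul_eq_zero.1 hu).resolve_left (hA.f_pos u).ne'
        exact abs_nonpos_iff.1 ((hψc u).trans hcu.le)
    have hzero : ∀ Ψ : X → ℝ, ∫ u, ψ u ∂(post μ Ψ) = 0 := fun Ψ =>
      integral_eq_zero_of_ae ((withDensity_absolutelyContinuous μ _).ae_le hψae)
    rw [hzero, hzero, sub_zero]
    exact ENNReal.toReal_nonneg
  have hN0 : N ≠ 0 := fun h0 => by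
    obtain ⟨u, hu⟩ := ((eLpNorm_eq_zero_iff hfm hp0).1 h0).exists
    exact (hA.f_pos u).ne' hu
  have hG0 : 2 * ENNReal.ofReal (g y) ^ 2 ≠ 0 := by
    simp [hA.g_pos y]
  have hH2top : H ^ 2 ≠ ⊤ := ENNReal.pow_ne_top hHtop
  have hnum0 : 2 * ENNReal.ofReal (g y) ^ 2 * M * N ≠ 0 :=
    mul_ne_zero (mul_ne_zero hG0 hM0) hN0
  have hquot : 2 * ENNReal.ofReal (g y) ^ 2 * M * N / H ^ 2 ≠ ⊤ := fun h0 =>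
    hR (by rw [h0, ENNReal.top_mul hE0])
  have hEtop : E ≠ ⊤ := fun h0 =>
    hR (by rw [h0, ENNReal.mul_top (ENNReal.div_ne_zero.2 ⟨hnum0, hH2top⟩)])
  have hH0 : H ≠ 0 := fun h0 => hquot <| by
    rw [h0, zero_pow two_ne_zero, ENNReal.div_zero hnum0]
  have hnumtop : 2 * ENNReal.ofReal (g y) ^ 2 * M * N ≠ ⊤ := fun h0 =>
    hquot (by rw [h0, ENNReal.top_div_of_ne_top hH2top])
  have hNtop : N ≠ ⊤ := fun h0 =>
    hnumtop (by rw [h0, ENNReal.mul_top (mul_ne_zero hG0 hM0)])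
  have hMtop : M ≠ ⊤ := fun h0 =>
    hnumtop (by rw [h0, ENNReal.mul_top hG0, ENNReal.top_mul hN0])
  have key := integral_post_sub_integral_post_le (ψ := ψ) (h := fun u => h u y) hp hpq
    (hA.g_pos y) (hA.measurable y) (hA'.measurable y) hA.f_pos (fun u => hA.h_pos u y) hψc
    (fun u => (hA.le_exp_and_exp_le u y).2) (fun u => (hA'.le_exp_and_exp_le u y).2)
    (fun u => (hA.le_exp_and_exp_le u y).1) (fun u => (hA'.le_exp_and_exp_le u y).1)
    ⟨hfcm, hMtop.lt_top⟩ ⟨hfm, hNtop.lt_top⟩ ⟨hΔm, hEtop.lt_top⟩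
    (ENNReal.toReal_pos hH0 hHtop)
  refine key.trans_eq ?_
  simp only [ENNReal.toReal_mul, ENNReal.toReal_div, ENNReal.toReal_pow,
    ENNReal.toReal_ofReal (hA.g_pos y).le, ENNReal.toReal_ofNat, ← hM, ← hN, ← hH, ← hE]
end

section
/- Suppose the likelihood potentials Φ and Φ' both satisfy Assumption A with the same functions (f,g,h), and let p,q ∈ [1,∞] satisfy 1/p + 1/q = 1. Then for every y ∈ Y the normalizing constants Z(y) = ∫_X exp(−Φ(u;y)) dμ(u) and Z'(y) = ∫_X exp(−Φ'(u;y)) dμ(u) satisfy |Z(y) − Z'(y)| ≤ g(y) ‖f‖_{L^p(μ)} ‖Φ(·;y) − Φ'(·;y)‖_{L^q(μ)}. -/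
open MeasureTheory Real ENNReal

theorem Real.abs_exp_sub_exp_le_mul_abs_sub {a b M : ℝ} (ha : Real.exp a ≤ M)
    (hb : Real.exp b ≤ M) : |Real.exp a - Real.exp b| ≤ M * |a - b| := by
  wlog hab : b ≤ a generalizing a b
  · rw [abs_sub_comm, abs_sub_comm a]
    exact this hb ha (le_of_not_ge hab)
  rw [abs_of_nonneg (sub_nonneg.2 (Real.exp_le_exp.2 hab)), abs_of_nonneg (sub_nonneg.2 hab)]
  have hexp : Real.exp b = Real.exp a * Real.exp (b - a) := by
    rw [← Real.exp_add, add_sub_cancel]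
  calc Real.exp a - Real.exp b = Real.exp a * (1 - Real.exp (b - a)) := by rw [hexp]; ring
    _ ≤ Real.exp a * (a - b) := by
        refine mul_le_mul_of_nonneg_left ?_ (Real.exp_pos a).le
        linarith [Real.add_one_le_exp (b - a)]
    _ ≤ M * (a - b) := mul_le_mul_of_nonneg_right ha (sub_nonneg.2 hab)

theorem AssumptionA.exp_neg_le {X Y : Type*} [MeasurableSpace X] [TopologicalSpace X]
    [TopologicalSpace Y] {μ : Measure X} {Φ : X → Y → ℝ} {f : X → ℝ} {g : Y → ℝ}
    {h : X → Y → ℝ} (hA : AssumptionA μ Φ f g h) (u : X) (y : Y) :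
    Real.exp (-Φ u y) ≤ g y * f u := by
  rw [← Real.le_log_iff_exp_le (mul_pos (hA.g_pos y) (hA.f_pos u)),
    Real.log_mul (hA.g_pos y).ne' (hA.f_pos u).ne']
  linarith [hA.lower_bound u y]

theorem AssumptionA.integrable_exp_neg {X Y : Type*} [MeasurableSpace X] [TopologicalSpace X]
    [TopologicalSpace Y] {μ : Measure X} {Φ : X → Y → ℝ} {f : X → ℝ} {g : Y → ℝ}
    {h : X → Y → ℝ} (hA : AssumptionA μ Φ f g h) (hf : Integrable f μ) (y : Y) :
    Integrable (fun u => Real.exp (-Φ u y)) μ := by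
  refine (hf.const_mul (g y)).mono' (hA.measurable y).neg.exp.aestronglyMeasurable
    (.of_forall fun u => ?_)
  rw [Real.norm_of_nonneg (Real.exp_pos _).le]
  exact hA.exp_neg_le u y

/-- If `Φ` and `Φ'` both satisfy Assumption A with the same `(f,g,h)` and
`1/p + 1/q = 1`, then the normalizing constants satisfy
`|Z(y) − Z'(y)| ≤ g(y) ‖f‖_{Lᵖ(μ)} ‖Φ(·;y) − Φ'(·;y)‖_{L^q(μ)}` for every `y`. -/
theorem normalizing_constant_perturbation
    {X Y : Type*} [NormedAddCommGroup X] [NormedSpace ℝ X] [CompleteSpace X]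
    [SecondCountableTopology X] [MeasurableSpace X] [BorelSpace X]
    [NormedAddCommGroup Y] [NormedSpace ℝ Y] [CompleteSpace Y] [SecondCountableTopology Y]
    (μ : Measure X) [IsProbabilityMeasure μ]
    (Φ Φ' : X → Y → ℝ) (f : X → ℝ) (g : Y → ℝ) (h : X → Y → ℝ)
    (hA : AssumptionA μ Φ f g h) (hA' : AssumptionA μ Φ' f g h)
    (p q : ℝ≥0∞) (hp : 1 ≤ p) (hq : 1 ≤ q) (hpq : 1 / p + 1 / q = 1)
    (y : Y) :
    ENNReal.ofReal |(∫ u, Real.exp (-Φ u y) ∂μ) - ∫ u, Real.exp (-Φ' u y) ∂μ| ≤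
      ENNReal.ofReal (g y) * eLpNorm f p μ *
        eLpNorm (fun u => Φ u y - Φ' u y) q μ := by
  have hf : AEStronglyMeasurable f μ := hA.f_lsc.measurable.aestronglyMeasurable
  have hd : AEStronglyMeasurable (fun u => Φ u y - Φ' u y) μ :=
    ((hA.measurable y).sub (hA'.measurable y)).aestronglyMeasurable
  have hg : ENNReal.ofReal (g y) ≠ 0 := by simpa using hA.g_pos y
  by_cases hd0 : eLpNorm (fun u => Φ u y - Φ' u y) q μ = 0
  · have hΦ : (fun u => Real.exp (-Φ u y)) =ᵐ[μ] fun u => Real.exp (-Φ' u y) := by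
      filter_upwards [(eLpNorm_eq_zero_iff hd (zero_lt_one.trans_le hq).ne').1 hd0] with u hu
      rw [sub_eq_zero.1 hu]
    simp [integral_congr_ae hΦ]
  by_cases hfp : eLpNorm f p μ = ∞
  · rw [hfp, ENNReal.mul_top hg, ENNReal.top_mul hd0]
    exact le_top
  have hfi : Integrable f μ := MemLp.integrable hp ⟨hf, lt_top_iff_ne_top.2 hfp⟩
  have : ENNReal.HolderTriple p q 1 := ⟨by simpa using hpq⟩
  have hbound : ∀ᵐ u ∂μ, ‖Real.exp (-Φ u y) - Real.exp (-Φ' u y)‖ ≤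
      g y * ‖f u • (Φ u y - Φ' u y)‖ := .of_forall fun u => by
    rw [norm_smul, Real.norm_of_nonneg (hA.f_pos u).le, ← mul_assoc, Real.norm_eq_abs,
      Real.norm_eq_abs, abs_sub_comm (Φ u y), ← neg_sub_neg (Φ u y) (Φ' u y)]
    exact Real.abs_exp_sub_exp_le_mul_abs_sub (hA.exp_neg_le u y) (hA'.exp_neg_le u y)
  rw [← integral_sub (hA.integrable_exp_neg hfi y) (hA'.integrable_exp_neg hfi y),
    ← Real.enorm_eq_ofReal_abs, mul_assoc]
  calc _ ≤ eLpNorm (fun u => Real.exp (-Φ u y) - Real.exp (-Φ' u y)) 1 μ := by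
        rw [eLpNorm_one_eq_lintegral_enorm]
        exact enorm_integral_le_lintegral_enorm _
    _ ≤ ENNReal.ofReal (g y) * eLpNorm (f • fun u => Φ u y - Φ' u y) 1 μ :=
        eLpNorm_le_mul_eLpNorm_of_ae_le_mul hbound 1
    _ ≤ _ := by
        gcongr
        exact eLpNorm_smul_le_mul_eLpNorm hd hf
end

section
/- Let X = [0,1]^d ⊂ ℝ^d, let G: ℝ^d → ℝ^m be a linear map, fix σ > 0 and y ∈ ℝ^m, and let Φ(u;y) = |Gu − y|²/(2σ²). Let ϱ be a Borel probability measure on X, let T, T*: X → X be continuous maps, and set μ = T_♯ϱ, μ* = T*_♯ϱ. Let ν and ν* be the posteriors with densities dν/dμ(u) = exp(−Φ(u;y))/Z(y) and dν*/dμ*(u) = exp(−Φ(u;y))/Z*(y), with Z(y), Z*(y) the corresponding normalizing constants, and let h(u,y) = exp( −(1/σ²)(‖G‖² |u|² + |y|²) ) where ‖G‖ is the operator norm of G. Then there exists a constant C > 0 depending only on G, σ and d such that W₁(ν, ν*) ≤ ( C (1 + |y|) (1 + ∫|u| dμ(u)) (1 + ∫|u|² dμ(u) + ∫|u|² dμ*(u))^{1/2}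 / ( ‖h(·,y)‖_{L¹(μ)} ‖h(·,y)‖_{L¹(μ*)} ) ) · ‖T − T*‖_{L²(ϱ)}. -/
open MeasureTheory Real ENNReal

/-- A finite measure and another one of the same mass are the marginals of their normalized
product. -/
theorem MeasureTheory.Measure.map_fst_snd_inv_smul_prod {X Y : Type*} [MeasurableSpace X]
    [MeasurableSpace Y] (α : Measure X) (β : Measure Y) [IsFiniteMeasure α] [IsFiniteMeasure β]
    (h : α Set.univ = β Set.univ) :
    ((α Set.univ)⁻¹ • α.prod β).map Prod.fst = α ∧
      ((α Set.univ)⁻¹ • α.prod β).map Prod.snd = β := by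
  rw [Measure.map_smul, Measure.map_smul, Measure.map_fst_prod, Measure.map_snd_prod, ← h,
    smul_smul]
  by_cases h0 : α Set.univ = 0
  · have hα : α = 0 := Measure.measure_univ_eq_zero.mp h0
    have hβ : β = 0 := Measure.measure_univ_eq_zero.mp (h ▸ h0)
    simp [hα, hβ]
  · rw [smul_smul, ENNReal.inv_mul_cancel h0 (measure_ne_top _ _)]
    simp

/-- Pushforwards of two probability densities are coupled by pushing forward their minimum
along both maps and coupling the excess masses independently. -/
theorem otCost_map_withDensity_le {Ω E : Type*} [MeasurableSpace Ω] [NormedAddCommGroup E]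
    [MeasurableSpace E] [BorelSpace E] [SecondCountableTopology E]
    (ϱ : Measure Ω) {a b : Ω → ℝ≥0∞} (ha : Measurable a) (hb : Measurable b)
    (ha1 : ∫⁻ u, a u ∂ϱ = 1) (hb1 : ∫⁻ u, b u ∂ϱ = 1) {S T : Ω → E}
    (hS : Measurable S) (hT : Measurable T) {D : ℝ} (hD : ∀ u v, ‖S u - T v‖ ≤ D) :
    otCost (fun u v => ‖u - v‖) ((ϱ.withDensity a).map S) ((ϱ.withDensity b).map T) ≤
      ∫⁻ u, min (a u) (b u) * ENNReal.ofReal ‖S u - T u‖ ∂ϱ +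
        ENNReal.ofReal D * ∫⁻ u, (a u - b u) ∂ϱ := by
  set κ := ϱ.withDensity fun u => min (a u) (b u) with hκ
  set α := ϱ.withDensity fun u => a u - b u with hα
  set β := ϱ.withDensity fun u => b u - a u with hβ
  have hmin : Measurable fun u => min (a u) (b u) := ha.min hb
  have hκα : κ + α = ϱ.withDensity a := by
    rw [hκ, hα, ← withDensity_add_left hmin]
    congr 1
    funext u
    rcases le_total (a u) (b u) with h | h <;> simp [h, tsub_eq_zero_of_le]
  have hκβ : κ + β = ϱ.withDensity b := by
    rw [hκ, hβ, ← withDensity_add_left hmin]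
    congr 1
    funext u
    rcases le_total (a u) (b u) with h | h <;> simp [h, tsub_eq_zero_of_le]
  have hα1 : κ Set.univ + α Set.univ = 1 := by
    rw [← Measure.add_apply, hκα, withDensity_apply _ MeasurableSet.univ, Measure.restrict_univ,
      ha1]
  have hβ1 : κ Set.univ + β Set.univ = 1 := by
    rw [← Measure.add_apply, hκβ, withDensity_apply _ MeasurableSet.univ, Measure.restrict_univ,
      hb1]
  have hκfin : κ Set.univ ≠ ⊤ := ne_top_of_le_ne_top one_ne_top (hα1 ▸ le_self_add)
  have hαfin : α Set.univ ≠ ⊤ := ne_top_of_le_ne_top one_ne_top (hα1 ▸ le_add_self)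
  have hβfin : β Set.univ ≠ ⊤ := ne_top_of_le_ne_top one_ne_top (hβ1 ▸ le_add_self)
  have : IsFiniteMeasure α := ⟨hαfin.lt_top⟩
  have : IsFiniteMeasure β := ⟨hβfin.lt_top⟩
  have hαβ : α Set.univ = β Set.univ := (ENNReal.add_right_inj hκfin).mp (hα1.trans hβ1.symm)
  have hST : Measurable fun u => (S u, T u) := hS.prodMk hT
  have hmap : Measurable (Prod.map S T) := hS.prodMap hT
  obtain ⟨hfst, hsnd⟩ := Measure.map_fst_snd_inv_smul_prod α β hαβ
  set γ := (α Set.univ)⁻¹ • α.prod β with hγ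
  set pl := κ.map (fun u => (S u, T u)) + γ.map (Prod.map S T) with hpl
  have hpl1 : pl.map Prod.fst = (ϱ.withDensity a).map S := by
    rw [hpl, Measure.map_add _ _ measurable_fst, Measure.map_map measurable_fst hST,
      Measure.map_map measurable_fst hmap, ← hκα, Measure.map_add _ _ hS]
    congr 1
    conv_rhs => rw [← hfst, Measure.map_map hS measurable_fst]
    rfl
  have hpl2 : pl.map Prod.snd = (ϱ.withDensity b).map T := by
    rw [hpl, Measure.map_add _ _ measurable_snd, Measure.map_map measurable_snd hST,
      Measure.map_map measurable_snd hmap, ← hκβ, Measure.map_add _ _ hT]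
    congr 1
    conv_rhs => rw [← hsnd, Measure.map_map hT measurable_snd]
    rfl
  have hprob : IsProbabilityMeasure pl := by
    constructor
    have h := congrArg (fun ν => ν Set.univ) hpl1
    simp only [Measure.map_apply measurable_fst MeasurableSet.univ,
      Measure.map_apply hS MeasurableSet.univ, Set.preimage_univ] at h
    rw [h, withDensity_apply _ MeasurableSet.univ, Measure.restrict_univ, ha1]
  have hc : Measurable fun p : E × E => ENNReal.ofReal ‖p.1 - p.2‖ := by fun_prop
  refine (iInf₂_le pl ⟨hpl1, hpl2, hprob⟩).trans ?_
  rw [hpl, lintegral_add_measure, lintegral_map hc hST, lintegral_map hc hmap]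
  refine add_le_add ?_ ?_
  · exact (lintegral_withDensity_eq_lintegral_mul _ hmin (hc.comp hST)).le
  · calc ∫⁻ p, ENNReal.ofReal ‖(Prod.map S T p).1 - (Prod.map S T p).2‖ ∂γ
        ≤ ∫⁻ _, ENNReal.ofReal D ∂γ :=
          lintegral_mono fun p => ENNReal.ofReal_le_ofReal (hD p.1 p.2)
      _ = ENNReal.ofReal D * α Set.univ := by
          rw [lintegral_const, ← hfst, Measure.map_apply measurable_fst MeasurableSet.univ,
            Set.preimage_univ]
      _ = ENNReal.ofReal D * ∫⁻ u, (a u - b u) ∂ϱ := by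
          rw [hα, withDensity_apply _ MeasurableSet.univ, Measure.restrict_univ]

/-- The posterior of a pushforward prior is the pushforward of the pulled-back posterior. -/
theorem post_map {Ω X : Type*} [MeasurableSpace Ω] [MeasurableSpace X] (ϱ : Measure Ω)
    {T : Ω → X} (hT : Measurable T) {Φ : X → ℝ} (hΦ : Measurable Φ) :
    post (ϱ.map T) Φ = (post ϱ (Φ ∘ T)).map T := by
  have hZ : ∫ v, Real.exp (-Φ v) ∂ϱ.map T = ∫ v, Real.exp (-(Φ ∘ T) v) ∂ϱ :=
    integral_map hT.aemeasurable (Measurable.aestronglyMeasurable (by fun_prop))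
  ext s hs
  rw [post, post, hZ, Measure.map_apply hT hs, withDensity_apply _ hs,
    withDensity_apply _ (hT hs), setLIntegral_map hs (by fun_prop) hT]
  rfl

/-- The density of a posterior with bounded positive likelihood integrates to one. -/
theorem lintegral_ofReal_div_integral {Ω : Type*} [MeasurableSpace Ω] {ϱ : Measure Ω}
    {e : Ω → ℝ} (he : Integrable e ϱ) (he0 : ∀ u, 0 ≤ e u) (hpos : 0 < ∫ u, e u ∂ϱ) :
    ∫⁻ u, ENNReal.ofReal (e u / ∫ v, e v ∂ϱ) ∂ϱ = 1 := by
  rw [← ofReal_integral_eq_lintegral_ofReal (he.div_const _)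
    (Filter.Eventually.of_forall fun u => div_nonneg (he0 u) hpos.le), integral_div,
    div_self hpos.ne', ENNReal.ofReal_one]

/-- Normalizing two nonnegative functions is stable in `L¹`. -/
theorem integral_abs_div_integral_sub_le {Ω : Type*} [MeasurableSpace Ω] {ϱ : Measure Ω}
    {e f : Ω → ℝ} (he : Integrable e ϱ) (hf : Integrable f ϱ) (hf0 : ∀ u, 0 ≤ f u)
    (hepos : 0 < ∫ u, e u ∂ϱ) (hfpos : 0 < ∫ u, f u ∂ϱ) :
    ∫ u, |e u / (∫ v, e v ∂ϱ) - f u / ∫ v, f v ∂ϱ| ∂ϱ ≤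
      2 / (∫ v, e v ∂ϱ) * ∫ u, |e u - f u| ∂ϱ := by
  set Z := ∫ v, e v ∂ϱ with hZ
  set W := ∫ v, f v ∂ϱ with hW
  have hdiff : |W - Z| ≤ ∫ u, |e u - f u| ∂ϱ := by
    rw [abs_sub_comm, hZ, hW, ← integral_sub he hf]
    exact abs_integral_le_integral_abs
  have hpt : ∀ u, |e u / Z - f u / W| ≤ |e u - f u| / Z + f u * (|W - Z| / (Z * W)) := by
    intro u
    have h1 : e u / Z - f u / W = (e u - f u) / Z + f u * ((W - Z) / (Z * W)) := by
      field_simp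
      ring
    rw [h1]
    refine (abs_add_le _ _).trans_eq ?_
    rw [abs_div, abs_mul, abs_div, abs_of_pos hepos, abs_of_pos (mul_pos hepos hfpos),
      abs_of_nonneg (hf0 u)]
  have habs : Integrable (fun u => |e u - f u|) ϱ := (he.sub hf).abs
  calc ∫ u, |e u / Z - f u / W| ∂ϱ
      ≤ ∫ u, (|e u - f u| / Z + f u * (|W - Z| / (Z * W))) ∂ϱ :=
        integral_mono ((he.div_const _).sub (hf.div_const _)).abs
          ((habs.div_const _).add (hf.mul_const _)) hpt
    _ = (∫ u, |e u - f u| ∂ϱ) / Z + W * (|W - Z| / (Z * W)) := by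
        rw [integral_add (habs.div_const _) (hf.mul_const _), integral_div, integral_mul_const]
    _ = (∫ u, |e u - f u| ∂ϱ) / Z + |W - Z| / Z := by
        field_simp
    _ ≤ (∫ u, |e u - f u| ∂ϱ) / Z + (∫ u, |e u - f u| ∂ϱ) / Z := by gcongr
    _ = 2 / Z * ∫ u, |e u - f u| ∂ϱ := by ring

/-- Points of the unit cube have Euclidean norm at most `√d`. -/
theorem EuclideanSpace.norm_le_sqrt_of_mem_Icc {d : ℕ} {x : EuclideanSpace ℝ (Fin d)}
    (hx : ∀ i, x i ∈ Set.Icc (0 : ℝ) 1) : ‖x‖ ≤ √d := by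
  rw [EuclideanSpace.norm_eq]
  refine Real.sqrt_le_sqrt ?_
  calc ∑ i, ‖x i‖ ^ 2 ≤ ∑ _i : Fin d, (1 : ℝ) := by
        refine Finset.sum_le_sum fun i _ => ?_
        rw [Real.norm_of_nonneg (hx i).1]
        exact pow_le_one₀ (hx i).1 (hx i).2
    _ = d := by simp

/-- The difference of two points of the unit cube has norm at most `√d`. -/
theorem EuclideanSpace.norm_sub_le_sqrt_of_mem_Icc {d : ℕ} {x z : EuclideanSpace ℝ (Fin d)}
    (hx : ∀ i, x i ∈ Set.Icc (0 : ℝ) 1) (hz : ∀ i, z i ∈ Set.Icc (0 : ℝ) 1) :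
    ‖x - z‖ ≤ √d := by
  rw [EuclideanSpace.norm_eq]
  refine Real.sqrt_le_sqrt ?_
  calc ∑ i, ‖(x - z) i‖ ^ 2 ≤ ∑ _i : Fin d, (1 : ℝ) := by
        refine Finset.sum_le_sum fun i _ => ?_
        refine pow_le_one₀ (norm_nonneg _) ?_
        rw [Real.norm_eq_abs, PiLp.sub_apply, abs_le]
        constructor <;> linarith [(hx i).1, (hx i).2, (hz i).1, (hz i).2]
    _ = d := by simp

theorem abs_exp_neg_sub_exp_neg_le_s17 {s t : ℝ} (hs : 0 ≤ s) (ht : 0 ≤ t) :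
    |Real.exp (-s) - Real.exp (-t)| ≤ |s - t| := by
  wlog h : s ≤ t generalizing s t
  · rw [abs_sub_comm, abs_sub_comm s]
    exact this ht hs (le_of_not_ge h)
  have h1 : Real.exp (-t) ≤ Real.exp (-s) := Real.exp_le_exp.mpr (by linarith)
  rw [abs_of_nonneg (sub_nonneg.mpr h1), abs_of_nonpos (by linarith)]
  have h2 : Real.exp (-t) = Real.exp (-s) * Real.exp (s - t) := by
    rw [← Real.exp_add]; ring_nf
  have h3 : Real.exp (-s) ≤ 1 := Real.exp_le_one_iff.mpr (by linarith)
  have h4 := Real.add_one_le_exp (s - t)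
  have h5 := Real.exp_pos (-s)
  rw [h2]
  nlinarith

section GaussianLikelihood

variable {E F : Type*} [NormedAddCommGroup E] [NormedSpace ℝ E] [NormedAddCommGroup F]
  [NormedSpace ℝ F]

/-- On a ball of radius `R` the Gaussian likelihood is Lipschitz. -/
theorem abs_exp_neg_misfit_sub_le {σ R : ℝ} (hσ : 0 < σ) (hR : 0 ≤ R) (G : E →L[ℝ] F) (y : F)
    {u v : E} (hu : ‖u‖ ≤ R) (hv : ‖v‖ ≤ R) :
    |Real.exp (-(‖G u - y‖ ^ 2 / (2 * σ ^ 2))) - Real.exp (-(‖G v - y‖ ^ 2 / (2 * σ ^ 2)))| ≤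
      ‖G‖ * (‖G‖ * R + 1) / σ ^ 2 * (1 + ‖y‖) * ‖u - v‖ := by
  refine (abs_exp_neg_sub_exp_neg_le_s17 (by positivity) (by positivity)).trans ?_
  have hsum : ∀ w : E, ‖w‖ ≤ R → ‖G w - y‖ ≤ (‖G‖ * R + 1) * (1 + ‖y‖) := by
    intro w hw
    have h1 : ‖G w‖ ≤ ‖G‖ * R := (G.le_opNorm w).trans (by gcongr)
    have h2 : 0 ≤ ‖G‖ * R := by positivity
    nlinarith [norm_sub_le (G w) y, norm_nonneg y]
  have hdiff : |‖G u - y‖ - ‖G v - y‖| ≤ ‖G‖ * ‖u - v‖ := by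
    refine (abs_norm_sub_norm_le _ _).trans ?_
    rw [sub_sub_sub_cancel_right, ← map_sub]
    exact G.le_opNorm _
  have hprod : |‖G u - y‖ ^ 2 - ‖G v - y‖ ^ 2| ≤
      (‖G‖ * ‖u - v‖) * (2 * ((‖G‖ * R + 1) * (1 + ‖y‖))) := by
    rw [sq_sub_sq, mul_comm, abs_mul]
    refine mul_le_mul hdiff ?_ (abs_nonneg _) (by positivity)
    rw [abs_of_nonneg (by positivity)]
    linarith [hsum u hu, hsum v hv]
  rw [← sub_div, abs_div, abs_of_pos (by positivity : 0 < 2 * σ ^ 2),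
    div_le_iff₀ (by positivity)]
  refine hprod.trans_eq ?_
  field_simp

/-- The Gaussian likelihood is bounded below by a centred Gaussian in both variables. -/
theorem exp_neg_sq_add_sq_le_exp_neg_misfit {σ : ℝ} (hσ : 0 < σ) (G : E →L[ℝ] F) (y : F)
    (u : E) :
    Real.exp (-(1 / σ ^ 2) * (‖G‖ ^ 2 * ‖u‖ ^ 2 + ‖y‖ ^ 2)) ≤
      Real.exp (-(‖G u - y‖ ^ 2 / (2 * σ ^ 2))) := by
  refine Real.exp_le_exp.mpr ?_
  rw [neg_mul, neg_le_neg_iff, div_le_iff₀ (by positivity)]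
  have h1 : ‖G u - y‖ ≤ ‖G‖ * ‖u‖ + ‖y‖ :=
    (norm_sub_le _ _).trans (by gcongr; exact G.le_opNorm u)
  have h2 : ‖G u - y‖ ^ 2 ≤ (‖G‖ * ‖u‖ + ‖y‖) ^ 2 := by gcongr
  calc ‖G u - y‖ ^ 2 ≤ 2 * (‖G‖ ^ 2 * ‖u‖ ^ 2 + ‖y‖ ^ 2) := by
        nlinarith [sq_nonneg (‖G‖ * ‖u‖ - ‖y‖)]
    _ = 1 / σ ^ 2 * (‖G‖ ^ 2 * ‖u‖ ^ 2 + ‖y‖ ^ 2) * (2 * σ ^ 2) := by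
        field_simp

end GaussianLikelihood

/-- On a probability space the `L¹` norm is at most the `L²` norm. -/
theorem integral_le_sqrt_integral_sq {Ω : Type*} [MeasurableSpace Ω] {ϱ : Measure Ω}
    [IsProbabilityMeasure ϱ] {f : Ω → ℝ} (hf : Integrable f ϱ)
    (hf2 : Integrable (fun u => f u ^ 2) ϱ) :
    ∫ u, f u ∂ϱ ≤ √(∫ u, f u ^ 2 ∂ϱ) := by
  refine Real.le_sqrt_of_sq_le ?_
  exact (even_two.convexOn_pow (𝕜 := ℝ)).map_integral_le (by fun_prop) isClosed_univ
    (Filter.Eventually.of_forall fun _ => Set.mem_univ _) hf hf2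

/-- Pushforward priors: for the linear-forward-map likelihood
`Φ(u;y) = |Gu − y|²/(2σ²)` on `X = [0,1]^d`, priors `μ = T_♯ϱ`, `μ* = T*_♯ϱ` and the
corresponding posteriors `ν, ν*`, there is a constant `C > 0` depending only on `G`, `σ`
and `d` such that
`W₁(ν,ν*) ≤ C (1+|y|)(1+∫|u|dμ)(1+∫|u|²dμ+∫|u|²dμ*)^{1/2} /
(‖h(·,y)‖_{L¹(μ)} ‖h(·,y)‖_{L¹(μ*)}) · ‖T − T*‖_{L²(ϱ)}` with
`h(u,y) = exp(−(1/σ²)(‖G‖²|u|² + |y|²))`. -/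
theorem pushforward_prior_posterior_bound
    {d m : ℕ} (σ : ℝ) (hσ : 0 < σ)
    (G : EuclideanSpace ℝ (Fin d) →L[ℝ] EuclideanSpace ℝ (Fin m)) :
    ∃ C : ℝ, 0 < C ∧
      ∀ (y : EuclideanSpace ℝ (Fin m)) (ϱ : Measure (EuclideanSpace ℝ (Fin d))),
        IsProbabilityMeasure ϱ →
        ϱ {u | ∀ i, u i ∈ Set.Icc (0 : ℝ) 1} = 1 →
        ∀ (T T_ast : EuclideanSpace ℝ (Fin d) → EuclideanSpace ℝ (Fin d)),
          Continuous T → Continuous T_ast →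
          (∀ u i, T u i ∈ Set.Icc (0 : ℝ) 1) →
          (∀ u i, T_ast u i ∈ Set.Icc (0 : ℝ) 1) →
          otCost (fun u v => ‖u - v‖)
              (post (ϱ.map T) fun u => ‖G u - y‖ ^ 2 / (2 * σ ^ 2))
              (post (ϱ.map T_ast) fun u => ‖G u - y‖ ^ 2 / (2 * σ ^ 2)) ≤
            ENNReal.ofReal
              (C * (1 + ‖y‖) * (1 + ∫ u, ‖u‖ ∂ϱ.map T) *
                Real.sqrt (1 + (∫ u, ‖u‖ ^ 2 ∂ϱ.map T) + ∫ u, ‖u‖ ^ 2 ∂ϱ.map T_ast) /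
                ((∫ u, Real.exp (-(1 / σ ^ 2) * (‖G‖ ^ 2 * ‖u‖ ^ 2 + ‖y‖ ^ 2)) ∂ϱ.map T) *
                  ∫ u, Real.exp (-(1 / σ ^ 2) * (‖G‖ ^ 2 * ‖u‖ ^ 2 + ‖y‖ ^ 2)) ∂ϱ.map T_ast) *
                Real.sqrt (∫ u, ‖T u - T_ast u‖ ^ 2 ∂ϱ)) := by
  set K := ‖G‖ * (‖G‖ * √d + 1) / σ ^ 2 with hK
  have hK0 : 0 ≤ K := by positivity
  refine ⟨1 + 2 * √d * K, by positivity, ?_⟩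
  intro y ϱ _ _ T S hTc hSc hT hS
  have hTn : ∀ u, ‖T u‖ ≤ √d := fun u => EuclideanSpace.norm_le_sqrt_of_mem_Icc (hT u)
  have hSn : ∀ u, ‖S u‖ ≤ √d := fun u => EuclideanSpace.norm_le_sqrt_of_mem_Icc (hS u)
  have hD : ∀ u v, ‖T u - S v‖ ≤ √d := fun u v =>
    EuclideanSpace.norm_sub_le_sqrt_of_mem_Icc (hT u) (hS v)
  have hbdd : ∀ {f : EuclideanSpace ℝ (Fin d) → ℝ} (c : ℝ) (η : Measure _)
      [IsProbabilityMeasure η], Continuous f → (∀ u, 0 ≤ f u) → (∀ u, f u ≤ c) →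
      Integrable f η := by
    intro f c η _ hf h0 h1
    refine Integrable.of_bound hf.aestronglyMeasurable c (Filter.Eventually.of_forall fun u => ?_)
    rw [Real.norm_of_nonneg (h0 u)]
    exact h1 u
  set Φ : EuclideanSpace ℝ (Fin d) → ℝ := fun u => ‖G u - y‖ ^ 2 / (2 * σ ^ 2) with hΦ
  have hΦc : Continuous Φ := by fun_prop
  have hΦ0 : ∀ u, 0 ≤ Φ u := fun u => by positivity
  have hexp1 : ∀ u, Real.exp (-Φ u) ≤ 1 := fun u =>
    Real.exp_le_one_iff.mpr (neg_nonpos.mpr (hΦ0 u))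
  set h : EuclideanSpace ℝ (Fin d) → ℝ := fun u =>
    Real.exp (-(1 / σ ^ 2) * (‖G‖ ^ 2 * ‖u‖ ^ 2 + ‖y‖ ^ 2)) with hh
  have hhc : Continuous h := by fun_prop
  have hh0 : ∀ u, 0 < h u := fun u => Real.exp_pos _
  have hhe : ∀ u, h u ≤ Real.exp (-Φ u) := exp_neg_sq_add_sq_le_exp_neg_misfit hσ G y
  have hh1 : ∀ u, h u ≤ 1 := fun u => (hhe u).trans (hexp1 u)
  have : IsProbabilityMeasure (ϱ.map T) :=
    Measure.isProbabilityMeasure_map hTc.measurable.aemeasurable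
  have : IsProbabilityMeasure (ϱ.map S) :=
    Measure.isProbabilityMeasure_map hSc.measurable.aemeasurable
  have hHpos : ∀ (η : Measure (EuclideanSpace ℝ (Fin d))) [IsProbabilityMeasure η],
      0 < ∫ u, h u ∂η := fun η _ =>
    integral_exp_pos (hbdd 1 η hhc (fun u => (hh0 u).le) hh1)
  set H := ∫ u, h u ∂ϱ.map T with hH
  set H' := ∫ u, h u ∂ϱ.map S with hH'
  have hHp : 0 < H := hHpos _
  have hHp' : 0 < H' := hHpos _
  have hH1' : H' ≤ 1 := by
    calc H' ≤ ∫ _, (1 : ℝ) ∂ϱ.map S :=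
          integral_mono (hbdd 1 _ hhc (fun u => (hh0 u).le) hh1) (integrable_const _) hh1
      _ = 1 := by simp
  set e : EuclideanSpace ℝ (Fin d) → ℝ := fun u => Real.exp (-(Φ ∘ T) u) with he
  set f : EuclideanSpace ℝ (Fin d) → ℝ := fun u => Real.exp (-(Φ ∘ S) u) with hf
  have hec : Continuous e := by fun_prop
  have hfc : Continuous f := by fun_prop
  have hei : Integrable e ϱ :=
    hbdd 1 ϱ hec (fun u => (Real.exp_pos _).le) fun u => hexp1 (T u)
  have hfi : Integrable f ϱ :=
    hbdd 1 ϱ hfc (fun u => (Real.exp_pos _).le) fun u => hexp1 (S u)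
  set Z := ∫ u, e u ∂ϱ with hZ
  have hZp : 0 < Z := integral_exp_pos hei
  have hWp : 0 < ∫ u, f u ∂ϱ := integral_exp_pos hfi
  have hHZ : H ≤ Z := by
    rw [hH, integral_map hTc.measurable.aemeasurable hhc.aestronglyMeasurable]
    exact integral_mono
      (hbdd 1 ϱ (hhc.comp hTc) (fun u => (hh0 _).le) fun u => hh1 _) hei fun u => hhe (T u)
  have hΔ : Integrable (fun u => ‖T u - S u‖) ϱ :=
    hbdd √d ϱ (by fun_prop) (fun u => norm_nonneg _) fun u => hD u u
  set L := √(∫ u, ‖T u - S u‖ ^ 2 ∂ϱ) with hL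
  have hΔL : ∫ u, ‖T u - S u‖ ∂ϱ ≤ L :=
    integral_le_sqrt_integral_sq hΔ
      (hbdd (√d ^ 2) ϱ (by fun_prop) (fun u => by positivity) fun u => by
        gcongr; exact hD u u)
  have hef : ∫ u, |e u - f u| ∂ϱ ≤ K * (1 + ‖y‖) * L := by
    calc ∫ u, |e u - f u| ∂ϱ ≤ ∫ u, K * (1 + ‖y‖) * ‖T u - S u‖ ∂ϱ :=
          integral_mono (hei.sub hfi).abs (hΔ.const_mul _) fun u =>
            abs_exp_neg_misfit_sub_le hσ (Real.sqrt_nonneg _) G y (hTn u) (hSn u)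
      _ ≤ K * (1 + ‖y‖) * L := by rw [integral_const_mul]; gcongr
  have hmin : ∫⁻ u, min (ENNReal.ofReal (e u / Z)) (ENNReal.ofReal (f u / ∫ v, f v ∂ϱ)) *
      ENNReal.ofReal ‖T u - S u‖ ∂ϱ ≤ ENNReal.ofReal (1 / Z * L) := by
    calc _ ≤ ∫⁻ u, ENNReal.ofReal (1 / Z * ‖T u - S u‖) ∂ϱ := by
          refine lintegral_mono fun u => ?_
          rw [ENNReal.ofReal_mul (by positivity)]
          gcongr
          refine (min_le_left _ _).trans (ENNReal.ofReal_le_ofReal ?_)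
          gcongr
          exact hexp1 (T u)
      _ = ENNReal.ofReal (∫ u, 1 / Z * ‖T u - S u‖ ∂ϱ) :=
          (ofReal_integral_eq_lintegral_ofReal (hΔ.const_mul _)
            (Filter.Eventually.of_forall fun u => by positivity)).symm
      _ ≤ ENNReal.ofReal (1 / Z * L) := by
          rw [integral_const_mul]
          gcongr
  have hexcess : ∫⁻ u, (ENNReal.ofReal (e u / Z) - ENNReal.ofReal (f u / ∫ v, f v ∂ϱ)) ∂ϱ ≤
      ENNReal.ofReal (2 / Z * (K * (1 + ‖y‖) * L)) := by
    calc _ ≤ ∫⁻ u, ENNReal.ofReal |e u / Z - f u / ∫ v, f v ∂ϱ| ∂ϱ := by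
          refine lintegral_mono fun u => ?_
          rw [← ENNReal.ofReal_sub _ (div_nonneg (Real.exp_pos _).le hWp.le)]
          exact ENNReal.ofReal_le_ofReal (le_abs_self _)
      _ = ENNReal.ofReal (∫ u, |e u / Z - f u / ∫ v, f v ∂ϱ| ∂ϱ) :=
          (ofReal_integral_eq_lintegral_ofReal ((hei.div_const _).sub (hfi.div_const _)).abs
            (Filter.Eventually.of_forall fun u => abs_nonneg _)).symm
      _ ≤ ENNReal.ofReal (2 / Z * (K * (1 + ‖y‖) * L)) := by
          refine ENNReal.ofReal_le_ofReal ((integral_abs_div_integral_sub_le hei hfi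
            (fun u => (Real.exp_pos _).le) hZp hWp).trans ?_)
          gcongr
  rw [post_map ϱ hTc.measurable hΦc.measurable, post_map ϱ hSc.measurable hΦc.measurable]
  refine (otCost_map_withDensity_le ϱ
    (ENNReal.measurable_ofReal.comp (hec.measurable.div_const _))
    (ENNReal.measurable_ofReal.comp (hfc.measurable.div_const _))
    (lintegral_ofReal_div_integral hei (fun u => (Real.exp_pos _).le) hZp)
    (lintegral_ofReal_div_integral hfi (fun u => (Real.exp_pos _).le) hWp)
    hTc.measurable hSc.measurable hD).trans ?_
  refine (add_le_add hmin (mul_le_mul_right hexcess _)).trans ?_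
  rw [← ENNReal.ofReal_mul (Real.sqrt_nonneg _), ← ENNReal.ofReal_add (by positivity)
    (by positivity)]
  refine ENNReal.ofReal_le_ofReal ?_
  have hM1 : 0 ≤ ∫ u, ‖u‖ ∂ϱ.map T := integral_nonneg fun u => norm_nonneg u
  have hM2 : 0 ≤ ∫ u, ‖u‖ ^ 2 ∂ϱ.map T := integral_nonneg fun u => by positivity
  have hM2' : 0 ≤ ∫ u, ‖u‖ ^ 2 ∂ϱ.map S := integral_nonneg fun u => by positivity
  have hsqrt : 1 ≤ √(1 + (∫ u, ‖u‖ ^ 2 ∂ϱ.map T) + ∫ u, ‖u‖ ^ 2 ∂ϱ.map S) :=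
    Real.one_le_sqrt.mpr (by linarith)
  have hmoments : 1 ≤ (1 + ∫ u, ‖u‖ ∂ϱ.map T) *
      √(1 + (∫ u, ‖u‖ ^ 2 ∂ϱ.map T) + ∫ u, ‖u‖ ^ 2 ∂ϱ.map S) :=
    one_le_mul_of_one_le_of_one_le (by linarith) hsqrt
  have hHZ' : H * H' ≤ Z := (mul_le_of_le_one_right hHp.le hH1').trans hHZ
  calc 1 / Z * L + √d * (2 / Z * (K * (1 + ‖y‖) * L))
      = (1 + 2 * √d * K * (1 + ‖y‖)) / Z * L := by ring
    _ ≤ (1 + 2 * √d * K) * (1 + ‖y‖) / Z * L := by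
        gcongr
        nlinarith [norm_nonneg y]
    _ ≤ (1 + 2 * √d * K) * (1 + ‖y‖) * ((1 + ∫ u, ‖u‖ ∂ϱ.map T) *
          √(1 + (∫ u, ‖u‖ ^ 2 ∂ϱ.map T) + ∫ u, ‖u‖ ^ 2 ∂ϱ.map S)) / (H * H') * L := by
        refine mul_le_mul_of_nonneg_right (div_le_div₀ (by positivity) ?_ (by positivity) hHZ')
          (Real.sqrt_nonneg _)
        exact le_mul_of_one_le_right (by positivity) hmoments
    _ = _ := by rw [← mul_assoc]
end
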